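/- Fix y > 0 and c > 1. Then the limit as X → ∞ of P₊(y, X, c) := (log X / X) · Σ_{N prime, X ≤ N ≤ cX} Σ_{χ ∈ D₊(N)} χ(⌈yX⌉^𝔭)/τ(χ) exists and equals ∫_1^c cos(2πy/x) dx. -/

import Mathlib

open Filter Topology Finset

/-- `⌈x⌉^𝔭`: the smallest prime number that is `≥ x`. -/
noncomputable def leastPrime (x : ℝ) : ℕ := sInf {p : ℕ | p.Prime ∧ x ≤ (p : ℝ)}

/-- The Gauss sum `τ(χ) = Σ_{b=1}^{N} χ(b) e^{2πib/N}`. -/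
noncomputable def gaussSum' {N : ℕ} (χ : DirichletCharacter ℂ N) : ℂ :=
  ∑ b ∈ Finset.Icc 1 N,
    χ ((b : ℕ) : ZMod N) * Complex.exp (2 * Real.pi * Complex.I * (b : ℂ) / (N : ℂ))

/-- `P₊(y, X, c)`. -/
noncomputable def Pplus (y X c : ℝ) : ℂ :=
  (Complex.ofReal (Real.log X / X)) *
    ∑ N ∈ (Finset.range (Nat.floor (c * X) + 1)).filter
        (fun N : ℕ => N.Prime ∧ X ≤ (N : ℝ) ∧ (N : ℝ) ≤ c * X),
      ∑ᶠ χ ∈ {χ : DirichletCharacter ℂ N | χ.IsPrimitive ∧ χ (-1) = 1},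
        χ ((leastPrime (y * X) : ℕ) : ZMod N) / gaussSum' χ


/-- Summing over the representatives `1, …, N` is summing over `ZMod N`. -/
lemma sum_Icc_natCast_eq_sum_zmod {M : Type*} [AddCommGroup M] (N : ℕ) [NeZero N]
    (f : ZMod N → M) : ∑ b ∈ Finset.Icc 1 N, f (b : ZMod N) = ∑ x, f x := by
  have hrange : ∑ b ∈ Finset.range N, f (b : ZMod N) = ∑ x, f x := by
    refine Finset.sum_bij' (fun b _ => (b : ZMod N)) (fun x _ => x.val) (by simp)
      (fun x _ => by simpa using ZMod.val_lt x) (fun b hb => ?_) (by simp) (by simp)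
    exact ZMod.val_cast_of_lt (by simpa using hb)
  rw [← hrange]
  have h1 : ∑ b ∈ Finset.Icc 1 N, f (b : ZMod N)
      = ∑ b ∈ Finset.range N, f ((b + 1 : ℕ) : ZMod N) := by
    rw [Finset.range_eq_Ico, Finset.sum_Ico_add' (fun b : ℕ => f (b : ZMod N)) 0 N 1]
    rfl
  have h2 := Finset.sum_range_succ' (fun b : ℕ => f (b : ZMod N)) N
  rw [Finset.sum_range_succ] at h2
  simp only [CharP.cast_eq_zero] at h2
  rw [h1]
  simpa using h2.symm

lemma gaussSum'_eq_gaussSum {N : ℕ} [NeZero N] (χ : DirichletCharacter ℂ N) :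
    gaussSum' χ = gaussSum χ ZMod.stdAddChar := by
  rw [gaussSum, ← sum_Icc_natCast_eq_sum_zmod, gaussSum']
  refine Finset.sum_congr rfl fun b _ => ?_
  rw [ZMod.stdAddChar_apply, ZMod.toCircle_natCast]

/-- Modulo a prime, the primitive Dirichlet characters are the nontrivial ones. -/
lemma isPrimitive_iff_ne_one_of_prime {N : ℕ} (hN : N.Prime) (χ : DirichletCharacter ℂ N) :
    χ.IsPrimitive ↔ χ ≠ 1 := by
  have : NeZero N := ⟨hN.ne_zero⟩
  have h := (Nat.dvd_prime hN).1 χ.conductor_dvd_level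
  rw [DirichletCharacter.isPrimitive_def, ne_eq,
    DirichletCharacter.eq_one_iff_conductor_eq_one]
  have := hN.ne_one
  grind

lemma inv_gaussSum_of_even {N : ℕ} [Fact N.Prime] {χ : DirichletCharacter ℂ N} (hχ : χ ≠ 1)
    (heven : χ (-1) = 1) :
    (gaussSum χ ZMod.stdAddChar)⁻¹ = gaussSum χ⁻¹ ZMod.stdAddChar / N := by
  have hN : (N : ℂ) ≠ 0 := by exact_mod_cast (Fact.out : N.Prime).ne_zero
  have h1 := gaussSum_mul_gaussSum_eq_card hχ (ZMod.isPrimitive_stdAddChar N)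
  have h2 := mul_gaussSum_inv_eq_gaussSum χ⁻¹ (ZMod.stdAddChar (N := N))
  rw [MulChar.inv_apply_eq_inv', heven, inv_one, one_mul] at h2
  rw [h2, ZMod.card] at h1
  have h3 : gaussSum χ ZMod.stdAddChar ≠ 0 := fun h => hN (by rw [← h1, h, zero_mul])
  field_simp
  rw [← h1]

/-- The average of `χ(m) / τ(χ)` over even primitive characters modulo a prime. -/
lemma finsum_even_primitive_eq {N : ℕ} (hN : N.Prime) {p : ℕ} (hp : ¬ N ∣ p) :
    ∑ᶠ χ ∈ {χ : DirichletCharacter ℂ N | χ.IsPrimitive ∧ χ (-1) = 1},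
        χ (p : ZMod N) / gaussSum' χ =
      (((N - 1) / N * Real.cos (2 * Real.pi * p / N) + 1 / N : ℝ) : ℂ) := by
  classical
  have : Fact N.Prime := ⟨hN⟩
  have hN0 : (N : ℂ) ≠ 0 := by exact_mod_cast hN.ne_zero
  have hm : (p : ZMod N) ≠ 0 := by rwa [ne_eq, ZMod.natCast_eq_zero_iff]
  obtain ⟨m, hmdef⟩ : ∃ m : ZMod N, m = (p : ZMod N) := ⟨_, rfl⟩
  rw [← hmdef] at hm ⊢
  have hfs : ∑ᶠ χ ∈ {χ : DirichletCharacter ℂ N | χ.IsPrimitive ∧ χ (-1) = 1},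
        χ m / gaussSum' χ = ∑ χ : DirichletCharacter ℂ N,
          ((1 + χ (-1)) / 2 * χ m * gaussSum χ⁻¹ ZMod.stdAddChar / N +
            if χ = 1 then 1 / (N : ℂ) else 0) := by
    rw [finsum_mem_def, finsum_eq_sum_of_fintype]
    refine Finset.sum_congr rfl fun χ _ => ?_
    simp only [Set.indicator_apply, Set.mem_ofPred_eq, isPrimitive_iff_ne_one_of_prime hN,
      gaussSum'_eq_gaussSum]
    by_cases h1 : χ = 1
    · subst h1
      have hne : (ZMod.stdAddChar : AddChar (ZMod N) ℂ) ≠ 1 := by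
        intro h
        have := ZMod.isPrimitive_stdAddChar N (one_ne_zero)
        simp [h] at this
      simp [gaussSum_one_left hne, MulChar.one_apply, hm]
      ring
    · rcases χ.even_or_odd with h | h
      · have h' : χ (-1) = 1 := h
        simp only [h1, h', not_false_eq_true, and_self, if_true, if_false, add_zero,
          div_eq_mul_inv (χ m), inv_gaussSum_of_even h1 h', ne_eq]
        ring
      · have h' : χ (-1) = -1 := h
        norm_num [h1, h']
  have hm' : IsUnit m := isUnit_iff_ne_zero.2 hm
  have hrefl : ∑ χ : DirichletCharacter ℂ N,
      (1 + χ (-1)) / 2 * χ m * gaussSum χ⁻¹ ZMod.stdAddChar =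
      ∑ χ : DirichletCharacter ℂ N, ∑ b : ZMod N, ZMod.stdAddChar b *
        ((χ m⁻¹ * χ b) + (χ (-m)⁻¹ * χ b)) / 2 := by
    rw [← Equiv.sum_comp (Equiv.inv _)]
    refine Finset.sum_congr rfl fun χ _ => ?_
    simp only [Equiv.inv_apply, inv_inv, gaussSum, Finset.mul_sum]
    refine Finset.sum_congr rfl fun b _ => ?_
    have h : χ (-m)⁻¹ = χ (-1) * χ m⁻¹ := by rw [← map_mul]; congr 1; rw [inv_neg]; ring
    rw [h, MulChar.inv_apply', MulChar.inv_apply', inv_neg, inv_one]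
    ring
  rw [hfs, Finset.sum_add_distrib, Finset.sum_ite_eq' Finset.univ, if_pos (Finset.mem_univ _),
    ← Finset.sum_div, hrefl, Finset.sum_comm]
  have hin : ∀ b : ZMod N, ∑ χ : DirichletCharacter ℂ N, ZMod.stdAddChar b *
        ((χ m⁻¹ * χ b) + (χ (-m)⁻¹ * χ b)) / 2 =
      ZMod.stdAddChar b * ((if m = b then (N.totient : ℂ) else 0) +
        (if -m = b then (N.totient : ℂ) else 0)) / 2 := by
    intro b
    rw [← Finset.sum_div, ← Finset.mul_sum, Finset.sum_add_distrib,
      DirichletCharacter.sum_char_inv_mul_char_eq ℂ hm',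
      DirichletCharacter.sum_char_inv_mul_char_eq ℂ hm'.neg]
  simp only [hin]
  simp only [← Finset.sum_div, mul_add, Finset.sum_add_distrib, mul_ite, mul_zero,
    Finset.sum_ite_eq, Finset.mem_univ, if_true]
  rw [Nat.totient_prime hN, Nat.cast_sub hN.one_le]
  have e1 : (ZMod.stdAddChar m : ℂ) = Complex.exp ((2 * Real.pi * p / N : ℝ) * Complex.I) := by
    have := ZMod.stdAddChar_coe (N := N) p
    rw [hmdef]; push_cast at this ⊢; rw [this]; congr 1; ring
  have e2 : (ZMod.stdAddChar (-m) : ℂ)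
      = Complex.exp (-(2 * Real.pi * p / N : ℝ) * Complex.I) := by
    have := ZMod.stdAddChar_coe (N := N) (-p)
    rw [hmdef]; push_cast at this ⊢; rw [this]; congr 1; ring
  rw [e1, e2, Complex.ofReal_add, Complex.ofReal_mul, Complex.ofReal_cos, Complex.cos]
  push_cast
  ring

open MeasureTheory in
/-- Pairing a bounded function, damped by `exp (-ε u)`, with a Fourier integral amounts to
integrating its Laplace transform over a vertical segment. -/
lemma integral_mul_fourier_eq_of_laplace {A : ℝ → ℝ} (hA : Measurable A) {M : ℝ}
    (hM : ∀ u, |A u| ≤ M) {G : ℂ → ℂ}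
    (hG : ∀ s : ℂ, 0 < s.re → ∫ u in Set.Ioi (0 : ℝ), (A u : ℂ) * Complex.exp (-s * u) = G s)
    {φ : ℝ → ℂ} (hφ : Continuous φ) (R x : ℝ) {ε : ℝ} (hε : 0 < ε) :
    ∫ u in Set.Ioi (0 : ℝ), (A u : ℂ) * Complex.exp (-ε * u) *
        ∫ t in Set.Icc (-R) R, φ t * Complex.exp (-(t * (u - x) : ℝ) * Complex.I) =
      ∫ t in Set.Icc (-R) R, φ t * G (ε + t * Complex.I) *
        Complex.exp ((t * x : ℝ) * Complex.I) := by
  have hintegrable : Integrable (Function.uncurry fun (u t : ℝ) => (A u : ℂ) * Complex.exp (-ε * u) *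
      (φ t * Complex.exp (-(t * (u - x) : ℝ) * Complex.I)))
      ((volume.restrict (Set.Ioi (0 : ℝ))).prod (volume.restrict (Set.Icc (-R) R))) := by
    have h1 : Integrable (fun u : ℝ => M * Real.exp (-ε * u))
        (volume.restrict (Set.Ioi (0 : ℝ))) :=
      (integrableOn_exp_mul_Ioi (neg_neg_of_pos hε) 0).const_mul M
    have h2 : Integrable (fun t : ℝ => ‖φ t‖) (volume.restrict (Set.Icc (-R) R)) :=
      hφ.norm.integrableOn_Icc
    refine (h1.mul_prod h2).mono ?_ (Filter.Eventually.of_forall fun z => ?_)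
    · refine Measurable.aestronglyMeasurable ?_
      have := hφ.measurable
      unfold Function.uncurry
      fun_prop
    · simp only [Function.uncurry]
      rw [norm_mul, norm_mul, norm_mul, ← Complex.ofReal_neg (z.2 * (z.1 - x)),
        Complex.norm_exp_ofReal_mul_I, mul_one, Complex.norm_real, ← Complex.ofReal_neg ε,
        ← Complex.ofReal_mul, ← Complex.ofReal_exp, Complex.norm_real, norm_mul, norm_norm,
        Real.norm_of_nonneg (Real.exp_pos _).le, norm_mul,
        Real.norm_of_nonneg (Real.exp_pos _).le]
      gcongr
      exact (hM _).trans (le_abs_self _)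
  simp only [← integral_const_mul]
  rw [integral_integral_swap hintegrable]
  refine integral_congr_ae (Filter.Eventually.of_forall fun t => ?_)
  simp only
  rw [← hG (ε + t * Complex.I) (by simpa using hε), ← integral_const_mul, ← integral_mul_const]
  refine integral_congr_ae (Filter.Eventually.of_forall fun u => ?_)
  simp only
  have : Complex.exp (-ε * u) * Complex.exp (-(t * (u - x) : ℝ) * Complex.I) =
      Complex.exp (-(ε + t * Complex.I) * u) * Complex.exp ((t * x : ℝ) * Complex.I) := by
    rw [← Complex.exp_add, ← Complex.exp_add]
    congr 1
    push_cast
    ring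
  linear_combination (A u : ℂ) * φ t * this

open MeasureTheory in
/-- If the Laplace transform of a bounded function extends continuously to the closed half plane
`0 ≤ re s`, then pairing the function with translates of an integrable band-limited kernel
tends to zero. -/
lemma tendsto_integral_mul_fourier_of_laplace {A : ℝ → ℝ} (hA : Measurable A) {M : ℝ}
    (hM : ∀ u, |A u| ≤ M) {G : ℂ → ℂ} (hGc : ContinuousOn G {s | 0 ≤ s.re})
    (hG : ∀ s : ℂ, 0 < s.re → ∫ u in Set.Ioi (0 : ℝ), (A u : ℂ) * Complex.exp (-s * u) = G s)
    {φ : ℝ → ℂ} (hφ : Continuous φ) (R : ℝ) {K : ℝ → ℂ} (hK : Integrable K)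
    (hKφ : ∀ᵐ v, ∫ t in Set.Icc (-R) R, φ t * Complex.exp (-(t * v : ℝ) * Complex.I) = K v) :
    Tendsto (fun x => ∫ u in Set.Ioi (0 : ℝ), (A u : ℂ) * K (u - x)) atTop (𝓝 0) := by
  have hlim : ∀ x, ∫ u in Set.Ioi (0 : ℝ), (A u : ℂ) * K (u - x) =
      ∫ t in Set.Icc (-R) R, φ t * G (t * Complex.I) *
        Complex.exp ((t * x : ℝ) * Complex.I) := by
    intro x
    have hKx : Integrable fun u => K (u - x) := hK.comp_sub_right x
    have hKφx : ∀ᵐ u : ℝ, ∫ t in Set.Icc (-R) R,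
        φ t * Complex.exp (-(t * (u - x) : ℝ) * Complex.I) = K (u - x) :=
      (measurePreserving_sub_right volume x).quasiMeasurePreserving.ae hKφ
    have hL : Tendsto (fun ε : ℝ => ∫ u in Set.Ioi (0 : ℝ),
        (A u : ℂ) * Complex.exp (-ε * u) * K (u - x)) (𝓝[>] 0)
        (𝓝 (∫ u in Set.Ioi (0 : ℝ), (A u : ℂ) * K (u - x))) := by
      refine tendsto_integral_filter_of_dominated_convergence (fun u => M * ‖K (u - x)‖) ?_ ?_
        (hKx.norm.const_mul M).integrableOn ?_
      · refine Filter.Eventually.of_forall fun ε => AEStronglyMeasurable.mul ?_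
          hKx.aestronglyMeasurable.restrict
        exact Measurable.aestronglyMeasurable (by fun_prop)
      · filter_upwards [self_mem_nhdsWithin] with ε hε
        filter_upwards [ae_restrict_mem measurableSet_Ioi] with u hu
        have hε' : 0 < ε := hε
        have hu' : 0 < u := hu
        rw [norm_mul, norm_mul, Complex.norm_real, Complex.norm_exp]
        have h1 : Real.exp (-(ε : ℂ) * u).re ≤ 1 := by
          have : (-(ε : ℂ) * u).re = -(ε * u) := by simp
          rw [this]
          exact Real.exp_le_one_iff.2 (by nlinarith)
        have h2 : ‖A u‖ * Real.exp (-(ε : ℂ) * u).re ≤ M * 1 :=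
          mul_le_mul (hM u) h1 (Real.exp_pos _).le ((abs_nonneg _).trans (hM u))
        simpa using mul_le_mul_of_nonneg_right h2 (norm_nonneg (K (u - x)))
      · refine Filter.Eventually.of_forall fun u => ?_
        have : Continuous fun ε : ℝ => (A u : ℂ) * Complex.exp (-ε * u) * K (u - x) := by fun_prop
        have h := (this.tendsto 0).mono_left (nhdsWithin_le_nhds (s := Set.Ioi 0))
        simpa using h
    have hR : Tendsto (fun ε : ℝ => ∫ t in Set.Icc (-R) R, φ t * G (ε + t * Complex.I) *
        Complex.exp ((t * x : ℝ) * Complex.I)) (𝓝[>] 0)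
        (𝓝 (∫ t in Set.Icc (-R) R, φ t * G (t * Complex.I) *
        Complex.exp ((t * x : ℝ) * Complex.I))) := by
      have hcomp : ContinuousOn (fun z : ℝ × ℝ => G (z.1 + z.2 * Complex.I))
          (Set.Icc 0 1 ×ˢ Set.Icc (-R) R) :=
        hGc.comp (by fun_prop) fun z hz => by simpa using hz.1.1
      obtain ⟨C, hC⟩ := (isCompact_Icc.prod isCompact_Icc).exists_bound_of_continuousOn hcomp
      have h01 : ∀ᶠ ε : ℝ in 𝓝[>] 0, ε ∈ Set.Icc (0 : ℝ) 1 := by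
        filter_upwards [Ioo_mem_nhdsGT (zero_lt_one' ℝ)] with ε hε
        exact ⟨hε.1.le, hε.2.le⟩
      refine tendsto_integral_filter_of_dominated_convergence (fun t => ‖φ t‖ * C) ?_ ?_
        (hφ.norm.integrableOn_Icc.mul_const C) ?_
      · filter_upwards [h01] with ε hε
        refine ContinuousOn.aestronglyMeasurable ?_ measurableSet_Icc
        have : ContinuousOn (fun t : ℝ => G (ε + t * Complex.I)) (Set.Icc (-R) R) :=
          hGc.comp (by fun_prop) fun z hz => by simpa using hε.1
        exact (hφ.continuousOn.mul this).mul (by fun_prop)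
      · filter_upwards [h01] with ε hε
        filter_upwards [ae_restrict_mem measurableSet_Icc] with t ht
        rw [norm_mul, Complex.norm_exp_ofReal_mul_I, mul_one, norm_mul]
        gcongr
        exact hC (ε, t) ⟨hε, ht⟩
      · filter_upwards [ae_restrict_mem measurableSet_Icc] with t ht
        refine Tendsto.mul_const _ (Tendsto.const_mul _ ?_)
        have h1 : ContinuousWithinAt (fun ε : ℝ => G (ε + t * Complex.I)) (Set.Ici 0) 0 := by
          have : ContinuousOn (fun ε : ℝ => G (ε + t * Complex.I)) (Set.Ici 0) :=
            hGc.comp (by fun_prop) fun z hz => by simpa using hz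
          exact this 0 Set.self_mem_Ici
        have h2 := h1.tendsto.mono_left (nhdsWithin_mono 0 Set.Ioi_subset_Ici_self)
        simpa using h2
    refine tendsto_nhds_unique hL (hR.congr' ?_)
    filter_upwards [self_mem_nhdsWithin] with ε hε
    rw [← integral_mul_fourier_eq_of_laplace hA hM hG hφ R x hε]
    refine integral_congr_ae ?_
    filter_upwards [ae_restrict_of_ae hKφx] with u hu
    rw [hu]
  simp only [hlim]
  have hRL := Real.tendsto_integral_exp_smul_cocompact
    ((Set.Icc (-R) R).indicator fun t : ℝ => φ t * G (t * Complex.I))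
  have hx : Tendsto (fun x : ℝ => -x / (2 * Real.pi)) atTop (cocompact ℝ) :=
    ((tendsto_neg_atTop_atBot.atBot_div_const (by positivity))).mono_right atBot_le_cocompact
  refine (hRL.comp hx).congr fun x => ?_
  rw [← integral_indicator measurableSet_Icc]
  refine integral_congr_ae (Filter.Eventually.of_forall fun t => ?_)
  simp only [Set.indicator_apply]
  split_ifs
  · rw [Circle.smul_def, Real.fourierChar_apply, smul_eq_mul, mul_comm]
    congr 3
    push_cast
    field_simp
  · simp

/-- The Fejér kernel on the real line, the Fourier transform of the triangle function
supported on `[-R, R]`. -/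
noncomputable def fejerKernel (R v : ℝ) : ℝ := 2 * (1 - Real.cos (R * v)) / (R * v ^ 2)

lemma fejerKernel_eq_mul {R : ℝ} (hR : R ≠ 0) (v : ℝ) :
    fejerKernel R v = R * fejerKernel 1 (R * v) := by
  rcases eq_or_ne v 0 with rfl | hv
  · simp [fejerKernel]
  · simp only [fejerKernel]
    field_simp

lemma fejerKernel_one_nonneg (v : ℝ) : 0 ≤ fejerKernel 1 v := by
  have := Real.cos_le_one (1 * v)
  exact div_nonneg (by linarith) (by positivity)

lemma fejerKernel_one_le (v : ℝ) : fejerKernel 1 v ≤ 5 * (1 + v ^ 2)⁻¹ := by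
  rcases eq_or_ne v 0 with rfl | hv
  · simp [fejerKernel]
  · have h1 := Real.one_sub_sq_div_two_le_cos (x := v)
    have h2 := Real.neg_one_le_cos v
    have hv2 : 0 < v ^ 2 := by positivity
    rw [fejerKernel, one_mul, one_mul, ← div_eq_mul_inv, div_le_div_iff₀ hv2 (by positivity)]
    nlinarith

lemma measurable_fejerKernel (R : ℝ) : Measurable (fejerKernel R) := by
  unfold fejerKernel
  fun_prop

lemma integrable_fejerKernel_one : MeasureTheory.Integrable (fejerKernel 1) := by
  refine (integrable_inv_one_add_sq.const_mul 5).mono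
    (measurable_fejerKernel 1).aestronglyMeasurable (Filter.Eventually.of_forall fun v => ?_)
  rw [Real.norm_of_nonneg (fejerKernel_one_nonneg v)]
  exact (fejerKernel_one_le v).trans (le_abs_self _)

lemma integral_fejerKernel_one_pos : 0 < ∫ v, fejerKernel 1 v := by
  rw [MeasureTheory.integral_pos_iff_support_of_nonneg fejerKernel_one_nonneg
    integrable_fejerKernel_one]
  have hsub : Set.Ioo (0 : ℝ) 1 ⊆ Function.support (fejerKernel 1) := by
    intro v hv
    have hcos : Real.cos v < 1 := by
      have := Real.cos_lt_cos_of_nonneg_of_le_pi le_rfl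
        (show v ≤ Real.pi by linarith [Real.pi_gt_three, hv.2]) hv.1
      rwa [Real.cos_zero] at this
    have hv0 := hv.1
    have : 0 < fejerKernel 1 v := by
      rw [fejerKernel, one_mul]
      exact div_pos (by linarith) (by positivity)
    exact this.ne'
  exact lt_of_lt_of_le (by simp) (MeasureTheory.measure_mono hsub)

lemma integral_one_sub_div_mul_cexp {R : ℝ} (hR : 0 < R) {a : ℂ} (ha : a ≠ 0) :
    ∫ t in (0 : ℝ)..R, ((1 - t / R : ℝ) : ℂ) * Complex.exp (a * t) =
      Complex.exp (a * R) / (R * a ^ 2) - 1 / a - 1 / (R * a ^ 2) := by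
  have hR' : (R : ℂ) ≠ 0 := by exact_mod_cast hR.ne'
  have hderiv : ∀ t ∈ Set.uIcc 0 R, HasDerivAt (fun t : ℝ =>
      (1 - (t : ℂ) / R) * Complex.exp (a * t) / a + Complex.exp (a * t) / (R * a ^ 2))
      (((1 - t / R : ℝ) : ℂ) * Complex.exp (a * t)) t := by
    intro t _
    have h0 : HasDerivAt (fun t : ℝ => (t : ℂ)) 1 t := Complex.ofRealCLM.hasDerivAt
    have h1 := (h0.const_mul a).cexp
    have h2 := (h0.div_const (R : ℂ)).const_sub 1
    convert! ((h2.mul h1).div_const a).add (h1.div_const (R * a ^ 2)) using 1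
    push_cast
    field_simp
    ring
  rw [intervalIntegral.integral_eq_sub_of_hasDerivAt hderiv
    (Continuous.intervalIntegrable (by fun_prop) _ _)]
  simp [div_self hR']
  ring

lemma integral_triangle_mul_cexp {R : ℝ} (hR : 0 < R) {v : ℝ} (hv : v ≠ 0) :
    ∫ t in Set.Icc (-R) R, ((1 - |t| / R : ℝ) : ℂ) * Complex.exp (-(t * v : ℝ) * Complex.I) =
      fejerKernel R v := by
  have hR' : (R : ℂ) ≠ 0 := by exact_mod_cast hR.ne'
  have hv' : (v : ℂ) ≠ 0 := by exact_mod_cast hv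
  have hc : Continuous fun t : ℝ =>
      ((1 - |t| / R : ℝ) : ℂ) * Complex.exp (-(t * v : ℝ) * Complex.I) := by fun_prop
  rw [MeasureTheory.integral_Icc_eq_integral_Ioc,
    ← intervalIntegral.integral_of_le (by linarith),
    ← intervalIntegral.integral_add_adjacent_intervals (hc.intervalIntegrable (-R) 0)
      (hc.intervalIntegrable 0 R)]
  have h1 := integral_one_sub_div_mul_cexp hR (a := -v * Complex.I) (by simp [hv])
  have h2 := integral_one_sub_div_mul_cexp hR (a := v * Complex.I) (by simp [hv])
  have e1 : ∫ t in (0 : ℝ)..R, ((1 - |t| / R : ℝ) : ℂ) *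
      Complex.exp (-(t * v : ℝ) * Complex.I) =
      ∫ t in (0 : ℝ)..R, ((1 - t / R : ℝ) : ℂ) * Complex.exp (-v * Complex.I * t) := by
    refine intervalIntegral.integral_congr fun t ht => ?_
    rw [Set.uIcc_of_le hR.le] at ht
    simp only [abs_of_nonneg ht.1]
    congr 2
    push_cast
    ring
  have e2 : ∫ t in (-R)..0, ((1 - |t| / R : ℝ) : ℂ) *
      Complex.exp (-(t * v : ℝ) * Complex.I) =
      ∫ t in (0 : ℝ)..R, ((1 - t / R : ℝ) : ℂ) * Complex.exp (v * Complex.I * t) := by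
    rw [← neg_zero, ← intervalIntegral.integral_comp_neg, neg_zero]
    refine intervalIntegral.integral_congr fun t ht => ?_
    rw [Set.uIcc_of_le hR.le] at ht
    simp only [abs_neg, abs_of_nonneg ht.1]
    congr 2
    push_cast
    ring
  rw [e1, e2, h1, h2, fejerKernel]
  push_cast
  rw [Complex.cos, mul_pow, mul_pow, Complex.I_sq, neg_sq]
  have hI : (1 : ℂ) / (-v * Complex.I) = - (1 / (v * Complex.I)) := by
    rw [neg_mul, div_neg]
  rw [hI, show (v : ℂ) * Complex.I * R = R * v * Complex.I by ring,
    show -(v : ℂ) * Complex.I * R = -(R * v) * Complex.I by ring]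
  field_simp
  ring

open MeasureTheory in
/-- Fejér means of a bounded function whose Laplace transform extends continuously to the closed
half plane tend to zero. -/
lemma tendsto_integral_mul_fejerKernel {A : ℝ → ℝ} (hA : Measurable A) {M : ℝ}
    (hM : ∀ u, |A u| ≤ M) (hA0 : ∀ u ≤ 0, A u = 0)
    {G : ℂ → ℂ} (hGc : ContinuousOn G {s | 0 ≤ s.re})
    (hG : ∀ s : ℂ, 0 < s.re → ∫ u in Set.Ioi (0 : ℝ), (A u : ℂ) * Complex.exp (-s * u) = G s)
    {R : ℝ} (hR : 0 < R) :
    Tendsto (fun x => ∫ w, A (x + w / R) * fejerKernel 1 w) atTop (𝓝 0) := by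
  have hK : Integrable fun v => (fejerKernel R v : ℂ) := by
    simp only [fejerKernel_eq_mul hR.ne']
    exact ((integrable_fejerKernel_one.comp_mul_left' hR.ne').const_mul R).ofReal
  have hlim := tendsto_integral_mul_fourier_of_laplace hA hM hGc hG
    (φ := fun t : ℝ => ((1 - |t| / R : ℝ) : ℂ)) (by fun_prop) R hK (by
      filter_upwards [compl_mem_ae_iff.2 (measure_singleton (0 : ℝ))] with v hv
      exact integral_triangle_mul_cexp hR hv)
  rw [← Complex.ofReal_zero] at hlim
  have heq : ∀ x, ∫ u in Set.Ioi (0 : ℝ), (A u : ℂ) * (fejerKernel R (u - x) : ℂ) =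
      ((∫ w, A (x + w / R) * fejerKernel 1 w : ℝ) : ℂ) := by
    intro x
    rw [setIntegral_eq_integral_of_forall_compl_eq_zero
      (fun u hu => by simp [hA0 u (by simpa using hu)])]
    simp only [← Complex.ofReal_mul]
    rw [integral_complex_ofReal, ← integral_add_right_eq_self _ x]
    congr 1
    have := Measure.integral_comp_div (fun v => A (v + x) * fejerKernel R v) R
    simp only [add_sub_cancel_right]
    rw [eq_comm, abs_of_pos hR, smul_eq_mul] at this
    rw [← mul_right_inj' hR.ne', this, ← integral_const_mul]
    refine integral_congr_ae (Filter.Eventually.of_forall fun w => ?_)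
    simp only [fejerKernel_eq_mul hR.ne', mul_div_cancel₀ _ hR.ne']
    rw [add_comm]
    ring
  simp only [heq] at hlim
  exact (Complex.continuous_re.tendsto _).comp hlim

open MeasureTheory in
/-- The mass of the Fejér kernel outside a large interval is small. -/
lemma exists_integral_fejerKernel_tail_le {h : ℝ} (hh : 0 < h) {η : ℝ} (hη : 0 < η) :
    ∃ R > 0, ∫ w, {w : ℝ | R * h < |w|}.indicator (fejerKernel 1) w ≤ η := by
  have hmeas : ∀ R : ℝ, MeasurableSet {w : ℝ | R * h < |w|} := fun R =>
    measurableSet_lt measurable_const measurable_norm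
  have hlim : Tendsto (fun R : ℝ => ∫ w, {w : ℝ | R * h < |w|}.indicator (fejerKernel 1) w)
      atTop (𝓝 (∫ _ : ℝ, (0 : ℝ))) := by
    refine tendsto_integral_filter_of_dominated_convergence (fejerKernel 1)
      (Filter.Eventually.of_forall fun R =>
        ((measurable_fejerKernel 1).indicator (hmeas R)).aestronglyMeasurable)
      (Filter.Eventually.of_forall fun R => Filter.Eventually.of_forall fun w => ?_)
      integrable_fejerKernel_one (Filter.Eventually.of_forall fun w => ?_)
    · refine (norm_indicator_le_norm_self _ _).trans ?_
      rw [Real.norm_of_nonneg (fejerKernel_one_nonneg w)]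
    · refine tendsto_const_nhds.congr' ?_
      filter_upwards [eventually_ge_atTop (|w| / h)] with R hR
      rw [Set.indicator_of_notMem]
      simpa using (div_le_iff₀ hh).1 hR
  rw [integral_zero] at hlim
  obtain ⟨R, hR, hR0⟩ := ((hlim.eventually_le_const hη).and (eventually_gt_atTop 0)).exists
  exact ⟨R, hR0, hR⟩

open MeasureTheory in
/-- If a function bounded by `M` is at least `L` on the `h`-neighbourhood of `x`, then its
rescaled Fejér mean at `x` is almost at least `L` times the total mass. -/
lemma mul_integral_fejerKernel_sub_le {A : ℝ → ℝ} (hA : Measurable A) {M : ℝ}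
    (hM : ∀ u, |A u| ≤ M) {x h R L : ℝ} (hR : 0 < R)
    (hL : ∀ u, |u - x| ≤ h → L ≤ A u) :
    L * ∫ w, fejerKernel 1 w ≤ (∫ w, A (x + w / R) * fejerKernel 1 w) +
      (M + |L|) * ∫ w, {w : ℝ | R * h < |w|}.indicator (fejerKernel 1) w := by
  have hmeas : MeasurableSet {w : ℝ | R * h < |w|} :=
    measurableSet_lt measurable_const measurable_norm
  have hi := integrable_fejerKernel_one
  have hAi : Integrable fun w => A (x + w / R) * fejerKernel 1 w :=
    hi.bdd_mul (c := M)
      (by fun_prop : Measurable fun w => A (x + w / R)).aestronglyMeasurable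
      (Filter.Eventually.of_forall fun w => hM _)
  have hti := (hi.indicator hmeas).const_mul (M + |L|)
  rw [← integral_const_mul, ← integral_const_mul, ← integral_add hAi hti]
  refine integral_mono (hi.const_mul L) (hAi.add hti) fun w => ?_
  have hk := fejerKernel_one_nonneg w
  simp only [Set.indicator_apply, Set.mem_ofPred_eq]
  split_ifs with hw
  · have := (abs_le.1 (hM (x + w / R))).1
    nlinarith [le_abs_self L]
  · have : L ≤ A (x + w / R) := by
      apply hL
      rw [add_sub_cancel_left, abs_div, abs_of_pos hR, div_le_iff₀ hR]
      linarith
    nlinarith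

/-- A **Tauberian theorem** of Wiener–Ikehara type: a bounded function `A` for which
`e ^ u * (A u + 1)` is monotone tends to zero as soon as its Laplace transform extends
continuously to the closed half plane. -/
theorem tendsto_zero_of_laplace_continuousOn {A : ℝ → ℝ} (hA : Measurable A) {M : ℝ}
    (hM : ∀ u, |A u| ≤ M) (hA0 : ∀ u ≤ 0, A u = 0)
    (hmono : ∀ u v, 0 < u → u ≤ v → Real.exp u * (A u + 1) ≤ Real.exp v * (A v + 1))
    (hpos : ∀ u, -1 ≤ A u)
    {G : ℂ → ℂ} (hGc : ContinuousOn G {s | 0 ≤ s.re})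
    (hG : ∀ s : ℂ, 0 < s.re → ∫ u in Set.Ioi (0 : ℝ), (A u : ℂ) * Complex.exp (-s * u) = G s) :
    Tendsto A atTop (𝓝 0) := by
  have hshift : ∀ u v, 0 < u → u ≤ v → Real.exp (u - v) * (A u + 1) ≤ A v + 1 := by
    intro u v hu huv
    rw [Real.exp_sub, div_mul_eq_mul_div, div_le_iff₀ (Real.exp_pos v), mul_comm (A v + 1)]
    exact hmono u v hu huv
  have hM0 : 0 ≤ M := (abs_nonneg _).trans (hM 0)
  set I := ∫ w, fejerKernel 1 w with hI
  have hIpos : 0 < I := integral_fejerKernel_one_pos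
  rw [Metric.tendsto_atTop']
  intro δ hδ
  have hδ' : 0 < min δ 1 := lt_min hδ one_pos
  obtain ⟨h, hh, hexp⟩ : ∃ h > 0, Real.exp (2 * h) * (1 + min δ 1 / 4) < 1 + min δ 1 / 2 := by
    have hc : ContinuousAt (fun h : ℝ => Real.exp (2 * h) * (1 + min δ 1 / 4)) 0 := by fun_prop
    have := hc.tendsto.eventually_lt_const (u := 1 + min δ 1 / 2) (by simp; linarith)
    obtain ⟨h, h1, h2⟩ := ((this.filter_mono (nhdsWithin_le_nhds (s := Set.Ioi 0))).and
      self_mem_nhdsWithin).exists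
    exact ⟨h, h2, h1⟩
  have hE : Real.exp (2 * h) ≤ 2 := by nlinarith [min_le_right δ 1, Real.exp_pos (2 * h)]
  have hE1 : Real.exp (2 * h) * Real.exp (-(2 * h)) = 1 := by rw [← Real.exp_add]; simp
  have hE2 : 1 ≤ Real.exp (2 * h) := Real.one_le_exp (by linarith)
  have hE3 := Real.exp_pos (-(2 * h))
  have hC : 0 < 3 * M + 4 := by linarith
  obtain ⟨R, hR, htail⟩ := exists_integral_fejerKernel_tail_le hh
    (η := I * (min δ 1 / 8) / (3 * M + 4)) (by positivity)
  set T := ∫ w, {w : ℝ | R * h < |w|}.indicator (fejerKernel 1) w with hT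
  have hT0 : 0 ≤ T := MeasureTheory.integral_nonneg fun w =>
    Set.indicator_nonneg (fun w _ => fejerKernel_one_nonneg w) w
  rw [le_div_iff₀ hC] at htail
  have hmean := tendsto_integral_mul_fejerKernel hA hM hA0 hGc hG hR
  rw [Metric.tendsto_atTop'] at hmean
  obtain ⟨N, hN⟩ := hmean (I * (min δ 1 / 8)) (by positivity)
  refine ⟨max (N + h) (2 * h), fun a ha => ?_⟩
  have haN : N + h < a := (le_max_left _ _).trans_lt ha
  have hah : 2 * h < a := (le_max_right _ _).trans_lt ha
  have hA1 := hpos a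
  have hAM := (abs_le.1 (hM a)).2
  refine lt_of_lt_of_le ?_ (min_le_left δ 1)
  rw [Real.dist_eq, sub_zero, abs_lt]
  constructor
  · set U := Real.exp (2 * h) * (A a + 1) - 1 with hU
    have hUb : |-U| ≤ 2 * M + 3 := by
      rw [abs_neg, abs_le]
      constructor <;> nlinarith
    have hle : ∀ u, |u - (a - h)| ≤ h → -U ≤ -A u := by
      intro u hu
      rw [abs_le] at hu
      have h1 := hshift u a (by linarith) (by linarith)
      have h2 : Real.exp (-(2 * h)) ≤ Real.exp (u - a) := Real.exp_le_exp.2 (by linarith)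
      have h3 := hpos u
      have h4 : Real.exp (-(2 * h)) * (A u + 1) ≤ A a + 1 :=
        (mul_le_mul_of_nonneg_right h2 (by linarith)).trans h1
      have h5 := mul_le_mul_of_nonneg_left h4 (Real.exp_pos (2 * h)).le
      rw [← mul_assoc, hE1] at h5
      linarith
    have key := mul_integral_fejerKernel_sub_le (A := fun u => -A u) hA.neg
      (M := M) (by simpa using hM) hR hle
    have hmn := hN (a - h) (by linarith)
    rw [Real.dist_eq, sub_zero, abs_lt] at hmn
    simp only [neg_mul, MeasureTheory.integral_neg] at key
    rw [← hI, ← hT] at key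
    have hb : (M + |-U|) * T ≤ I * (min δ 1 / 8) := by nlinarith
    have hUlow : -(min δ 1 / 4) < U := by
      by_contra hcon
      nlinarith
    nlinarith
  · set L := Real.exp (-(2 * h)) * (A a + 1) - 1 with hL
    have hLup : L ≤ A a := by nlinarith
    have hLb : |L| ≤ 2 * M + 3 := by
      rw [abs_le]
      constructor <;> nlinarith
    have hle : ∀ u, |u - (a + h)| ≤ h → L ≤ A u := by
      intro u hu
      rw [abs_le] at hu
      have h1 := hshift a u (by linarith) (by linarith)
      have h2 : Real.exp (-(2 * h)) ≤ Real.exp (a - u) := Real.exp_le_exp.2 (by linarith)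
      have h4 := (mul_le_mul_of_nonneg_right h2 (by linarith : 0 ≤ A a + 1)).trans h1
      linarith
    have key := mul_integral_fejerKernel_sub_le hA hM hR hle
    have hmn := hN (a + h) (by linarith)
    rw [Real.dist_eq, sub_zero, abs_lt] at hmn
    rw [← hI, ← hT] at key
    have hb : (M + |L|) * T ≤ I * (min δ 1 / 8) := by nlinarith
    have hLlow : L < min δ 1 / 4 := by
      by_contra hcon
      nlinarith
    have h6 : A a + 1 = Real.exp (2 * h) * (L + 1) := by
      rw [hL, sub_add_cancel, ← mul_assoc, hE1, one_mul]
    nlinarith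

open Chebyshev ArithmeticFunction in
/-- `s * ∫₁^∞ ψ(t) t ^ (-(s + 1)) dt` minus the pole of `-ζ' / ζ` at `1` extends continuously to
the line `re s = 1`. -/
lemma exists_continuousOn_mul_integral_psi_sub : ∃ F : ℂ → ℂ, ContinuousOn F {s | 1 ≤ s.re} ∧
    ∀ s : ℂ, 1 < s.re →
      s * ∫ t in Set.Ioi (1 : ℝ), (psi t : ℂ) * (t : ℂ) ^ (-(s + 1)) = F s + 1 / (s - 1) := by
  refine ⟨vonMangoldt.LFunctionResidueClassAux (1 : ZMod 1),
    vonMangoldt.continuousOn_LFunctionResidueClassAux _, fun s hs => ?_⟩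
  have h := vonMangoldt.eqOn_LFunctionResidueClassAux (q := 1) (a := 1) isUnit_one hs
  have hΛ : (fun n => (vonMangoldt.residueClass (1 : ZMod 1) n : ℂ))
      = fun n => ((vonMangoldt n : ℝ) : ℂ) := by
    funext n
    rw [vonMangoldt.residueClass, Set.indicator_of_mem]
    exact Subsingleton.elim _ _
  simp only [hΛ, Nat.totient_one, Nat.cast_one, inv_one] at h
  rw [h, sub_add_cancel]
  have hpsi : ∀ t : ℝ, ∑ k ∈ Finset.Icc 1 ⌊t⌋₊, vonMangoldt k = psi t := fun t => rfl
  rw [LSeries_eq_mul_integral_of_nonneg (fun n => vonMangoldt n) zero_le_one (by simpa using hs) ?_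
    fun n => vonMangoldt_nonneg]
  · simp only [← Complex.ofReal_sum, hpsi]
  · refine Asymptotics.IsBigO.of_bound (Real.log 4 + 4) (Filter.Eventually.of_forall fun n => ?_)
    have h1 := hpsi n
    rw [Nat.floor_natCast] at h1
    rw [h1, Real.norm_of_nonneg (psi_nonneg _), Real.rpow_one, Real.norm_of_nonneg n.cast_nonneg]
    exact psi_le_const_mul_self n.cast_nonneg

open MeasureTheory Chebyshev in
/-- The **prime number theorem** for the second Chebyshev function, in exponential coordinates. -/
lemma tendsto_psi_exp_mul_exp_neg :
    Tendsto (fun u => psi (Real.exp u) * Real.exp (-u)) atTop (𝓝 1) := by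
  obtain ⟨F, hFc, hF⟩ := exists_continuousOn_mul_integral_psi_sub
  set A : ℝ → ℝ := fun u => if 0 < u then psi (Real.exp u) * Real.exp (-u) - 1 else 0 with hAdef
  have hle : ∀ u, psi (Real.exp u) * Real.exp (-u) ≤ Real.log 4 + 4 := by
    intro u
    rw [Real.exp_neg, ← div_eq_mul_inv, div_le_iff₀ (Real.exp_pos u)]
    exact psi_le_const_mul_self (Real.exp_pos u).le
  have hnn : ∀ u, 0 ≤ psi (Real.exp u) * Real.exp (-u) := fun u =>
    mul_nonneg (psi_nonneg _) (Real.exp_pos _).le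
  have hlog : 0 ≤ Real.log 4 := Real.log_nonneg (by norm_num)
  have hmeas : Measurable A := by
    have := psi_mono.measurable
    exact Measurable.ite measurableSet_Ioi (by fun_prop) measurable_const
  have hbound : ∀ u, |A u| ≤ Real.log 4 + 4 := by
    intro u
    simp only [hAdef]
    split_ifs
    · rw [abs_le]
      constructor <;> linarith [hle u, hnn u]
    · simp only [abs_zero]
      linarith
  have hA : Tendsto A atTop (𝓝 0) := by
    refine tendsto_zero_of_laplace_continuousOn hmeas hbound (fun u hu => if_neg (not_lt.2 hu))
      (fun u v hu huv => ?_) (fun u => ?_)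
      (G := fun s => (F (1 + s) - 1) / (1 + s)) ?_ fun s hs => ?_
    · have he : ∀ w, Real.exp w * (psi (Real.exp w) * Real.exp (-w) - 1 + 1)
          = psi (Real.exp w) := by
        intro w
        rw [sub_add_cancel, mul_left_comm, ← Real.exp_add]
        simp
      simp only [hAdef, if_pos hu, if_pos (hu.trans_le huv), he]
      exact psi_mono (Real.exp_le_exp.2 huv)
    · simp only [hAdef]
      split_ifs
      · linarith [hnn u]
      · norm_num
    · refine ContinuousOn.div (ContinuousOn.sub (hFc.comp (by fun_prop) fun s hs => ?_)
        continuousOn_const) (by fun_prop) fun s hs h0 => ?_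
      · simpa using hs
      · have h1 := congrArg Complex.re h0
        have hs' : 0 ≤ s.re := hs
        simp at h1
        linarith
    · have hs1 : (1 + s) ≠ 0 := by
        intro h0
        have h1 := congrArg Complex.re h0
        simp at h1
        linarith
      have hs0 : s ≠ 0 := by rintro rfl; simp at hs
      have hFs := hF (1 + s) (by simpa using hs)
      have hcv := integral_image_eq_integral_abs_deriv_smul (s := Set.Ioi (0 : ℝ)) (f := Real.exp)
        (f' := Real.exp) measurableSet_Ioi (fun x _ => (Real.hasDerivAt_exp x).hasDerivWithinAt)
        Real.exp_injective.injOn (fun t : ℝ => (psi t : ℂ) * (t : ℂ) ^ (-(1 + s + 1)))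
      have himg : Real.exp '' Set.Ioi 0 = Set.Ioi 1 := by
        ext t
        constructor
        · rintro ⟨u, hu, rfl⟩
          exact Real.one_lt_exp_iff.2 hu
        · intro ht
          have ht' : (1 : ℝ) < t := ht
          exact ⟨Real.log t, Real.log_pos ht', Real.exp_log (by linarith)⟩
      rw [himg] at hcv
      have hpt : ∀ u : ℝ, |Real.exp u| • ((psi (Real.exp u) : ℂ) *
          (Real.exp u : ℂ) ^ (-(1 + s + 1))) =
          ((psi (Real.exp u) * Real.exp (-u) : ℝ) : ℂ) * Complex.exp (-s * u) := by
        intro u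
        rw [abs_of_pos (Real.exp_pos u), Complex.real_smul,
          Complex.cpow_def_of_ne_zero (by exact_mod_cast (Real.exp_pos u).ne'),
          ← Complex.ofReal_log (Real.exp_pos u).le, Real.log_exp]
        push_cast
        rw [mul_left_comm, ← Complex.exp_add, mul_assoc, ← Complex.exp_add]
        congr 2
        ring
      simp only [hpt] at hcv
      have hexpint : IntegrableOn (fun u : ℝ => Complex.exp (-s * u)) (Set.Ioi 0) :=
        integrableOn_exp_mul_complex_Ioi (by simpa using hs) 0
      have hpsiint : IntegrableOn (fun u : ℝ =>
          ((psi (Real.exp u) * Real.exp (-u) : ℝ) : ℂ) * Complex.exp (-s * u)) (Set.Ioi 0) := by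
        refine hexpint.bdd_mul (c := Real.log 4 + 4) ?_ (Filter.Eventually.of_forall fun u => ?_)
        · have := psi_mono.measurable
          exact (by fun_prop : Measurable _).aestronglyMeasurable
        · rw [Complex.norm_real, Real.norm_of_nonneg (hnn u)]
          exact hle u
      have hAu : ∫ u in Set.Ioi (0 : ℝ), (A u : ℂ) * Complex.exp (-s * u) =
          ∫ u in Set.Ioi (0 : ℝ), (((psi (Real.exp u) * Real.exp (-u) : ℝ) : ℂ) *
            Complex.exp (-s * u) - Complex.exp (-s * u)) := by
        refine setIntegral_congr_fun measurableSet_Ioi fun u hu => ?_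
        simp only [hAdef, if_pos (Set.mem_Ioi.1 hu)]
        push_cast
        ring
      rw [hAu, integral_sub hpsiint hexpint, ← hcv,
        integral_exp_mul_complex_Ioi (by simpa using hs)]
      rw [eq_comm, div_eq_iff hs1]
      simp only [Complex.ofReal_zero, mul_zero, Complex.exp_zero]
      rw [sub_mul, mul_comm _ (1 + s), hFs, add_sub_cancel_left]
      field_simp
      ring
  have h1 := hA.add_const 1
  rw [zero_add] at h1
  refine h1.congr' ?_
  filter_upwards [eventually_gt_atTop 0] with u hu
  simp only [hAdef, if_pos hu, sub_add_cancel]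

open Chebyshev in
/-- The **prime number theorem** for the second Chebyshev function. -/
theorem tendsto_psi_div_self : Tendsto (fun x => psi x / x) atTop (𝓝 1) := by
  refine (tendsto_psi_exp_mul_exp_neg.comp Real.tendsto_log_atTop).congr' ?_
  filter_upwards [eventually_gt_atTop 0] with x hx
  simp [Real.exp_neg, Real.exp_log hx, div_eq_mul_inv]

open Chebyshev in
/-- The **prime number theorem** for the first Chebyshev function. -/
theorem tendsto_theta_div_self : Tendsto (fun x => theta x / x) atTop (𝓝 1) := by
  have hsqrt : (fun x : ℝ => √x) =o[atTop] fun x => x := by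
    refine (Asymptotics.isLittleO_iff_tendsto' ?_).2 ?_
    · filter_upwards [eventually_gt_atTop 0] with x hx h0
      exact absurd h0 hx.ne'
    · simp only [Real.sqrt_div_self']
      exact Real.tendsto_sqrt_atTop.const_div_atTop 1
  have h := (isBigO_psi_sub_theta_sqrt.trans_isLittleO hsqrt).tendsto_div_nhds_zero
  have h2 := tendsto_psi_div_self.sub h
  rw [sub_zero] at h2
  refine h2.congr fun x => ?_
  simp only [Pi.sub_apply]
  ring

open Chebyshev in
/-- The **prime number theorem**. -/
theorem tendsto_primeCounting_mul_log_div :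
    Tendsto (fun x : ℝ => (Nat.primeCounting ⌊x⌋₊ : ℝ) * Real.log x / x) atTop (𝓝 1) := by
  have hO := (primeCounting_sub_theta_div_log_isBigO.mul
    (Asymptotics.isBigO_refl (fun x : ℝ => Real.log x / x) atTop))
  have h0 : Tendsto (fun x : ℝ => x / Real.log x ^ 2 * (Real.log x / x)) atTop (𝓝 0) := by
    refine Real.tendsto_log_atTop.inv_tendsto_atTop.congr' ?_
    filter_upwards [eventually_gt_atTop 1] with x hx
    have := Real.log_pos hx
    simp only [Pi.inv_apply]
    field_simp
  have h1 := (hO.trans_tendsto h0).add tendsto_theta_div_self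
  rw [zero_add] at h1
  refine h1.congr' ?_
  filter_upwards [eventually_gt_atTop 1] with x hx
  have := Real.log_pos hx
  field_simp
  ring

/-- The number of primes up to `v * X`, normalised by `log X / X`, tends to `v`. -/
lemma tendsto_log_div_mul_primeCounting {v : ℝ} (hv : 0 < v) :
    Tendsto (fun X : ℝ => Real.log X / X * (Nat.primeCounting ⌊v * X⌋₊ : ℝ)) atTop (𝓝 v) := by
  have hvX : Tendsto (fun X : ℝ => v * X) atTop atTop := tendsto_id.const_mul_atTop hv
  have h1 := tendsto_primeCounting_mul_log_div.comp hvX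
  have h2 : Tendsto (fun X : ℝ => 1 + Real.log v / Real.log X) atTop (𝓝 1) := by
    simpa using (Real.tendsto_log_atTop.const_div_atTop (Real.log v)).const_add 1
  have h3 := (h1.div h2 one_ne_zero).const_mul v
  simp only [div_one, mul_one] at h3
  refine h3.congr' ?_
  filter_upwards [eventually_gt_atTop 1, hvX.eventually_gt_atTop 1] with X hX hvX1
  have hl := Real.log_pos hX
  have hl2 := Real.log_pos hvX1
  have hmul := Real.log_mul hv.ne' (by linarith : X ≠ 0)
  simp only [Function.comp, Pi.div_apply]
  rw [show 1 + Real.log v / Real.log X = Real.log (v * X) / Real.log X by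
    rw [hmul]; field_simp; ring]
  field_simp

/-- An asymptotic Riemann sum over the primes in `(X, c * X]`. -/
lemma tendsto_log_div_mul_sum_prime {g g' : ℝ → ℝ} {c : ℝ} (hc : 1 < c)
    (hg : ∀ v ∈ Set.Icc 1 c, HasDerivAt g (g' v) v) (hg' : ContinuousOn g' (Set.Icc 1 c)) :
    Tendsto (fun X : ℝ => Real.log X / X *
        ∑ N ∈ (Finset.Ioc ⌊X⌋₊ ⌊c * X⌋₊).filter Nat.Prime, g (N / X))
      atTop (𝓝 (∫ v in (1 : ℝ)..c, g v)) := by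
  have hIcc : Set.uIcc 1 c = Set.Icc 1 c := Set.uIcc_of_le hc.le
  have hg'i : IntervalIntegrable g' MeasureTheory.volume 1 c :=
    ContinuousOn.intervalIntegrable (by rwa [hIcc])
  have hlim : Tendsto (fun X : ℝ => ∫ v in (1 : ℝ)..c,
      g' v * (Real.log X / X * (Nat.primeCounting ⌊v * X⌋₊ : ℝ))) atTop
      (𝓝 (∫ v in (1 : ℝ)..c, g' v * v)) := by
    refine intervalIntegral.tendsto_integral_filter_of_dominated_convergence
      (fun v => ‖g' v‖ * (c + 1)) (Filter.Eventually.of_forall fun X => ?_) ?_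
      (hg'i.norm.mul_const _) (Filter.Eventually.of_forall fun v hv => ?_)
    · rw [Set.uIoc_of_le hc.le]
      refine hg'i.1.aestronglyMeasurable.mul (Measurable.aestronglyMeasurable ?_)
      exact ((measurable_from_nat (f := fun n => (Nat.primeCounting n : ℝ))).comp
        (Nat.measurable_floor.comp (measurable_id.mul_const X))).const_mul _
    · filter_upwards [(tendsto_log_div_mul_primeCounting (zero_lt_one.trans hc)).eventually_le_const
        (lt_add_one c), eventually_ge_atTop 1] with X hX hX1
      refine Filter.Eventually.of_forall fun v hv => ?_
      rw [Set.uIoc_of_le hc.le] at hv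
      have hpos : 0 ≤ Real.log X / X := div_nonneg (Real.log_nonneg hX1) (by linarith)
      rw [norm_mul, Real.norm_of_nonneg (mul_nonneg hpos (Nat.cast_nonneg _))]
      refine mul_le_mul_of_nonneg_left (le_trans ?_ hX) (norm_nonneg _)
      refine mul_le_mul_of_nonneg_left (Nat.cast_le.2 (Nat.monotone_primeCounting
        (Nat.floor_le_floor ?_))) hpos
      exact mul_le_mul_of_nonneg_right hv.2 (by linarith)
    · rw [Set.uIoc_of_le hc.le] at hv
      exact (tendsto_log_div_mul_primeCounting (zero_lt_one.trans hv.1)).const_mul _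
  have hparts : ∫ v in (1 : ℝ)..c, g v = g c * c - g 1 * 1 - ∫ v in (1 : ℝ)..c, g' v * v := by
    have h := intervalIntegral.integral_mul_deriv_eq_deriv_mul (a := 1) (b := c) (u := g) (u' := g')
      (v := fun v => v) (v' := fun _ => 1) (fun x hx => hg x (by rwa [hIcc] at hx))
      (fun x _ => hasDerivAt_id x) hg'i intervalIntegrable_const
    simpa using h
  rw [hparts]
  have h1 := tendsto_log_div_mul_primeCounting zero_lt_one
  have hcX := tendsto_log_div_mul_primeCounting (zero_lt_one.trans hc)
  refine (((hcX.const_mul (g c)).sub (h1.const_mul (g 1))).sub hlim).congr' ?_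
  filter_upwards [eventually_gt_atTop 0] with X hX
  have hpi : ∀ t : ℝ, ∑ k ∈ Finset.Icc 0 ⌊t⌋₊, (if k.Prime then (1 : ℝ) else 0)
      = Nat.primeCounting ⌊t⌋₊ := by
    intro t
    rw [Nat.primeCounting, Nat.primeCounting', Nat.count_eq_card_filter_range, Finset.sum_boole,
      ← Nat.range_succ_eq_Icc_zero]
  have hmem : ∀ t ∈ Set.Icc X (c * X), t / X ∈ Set.Icc 1 c := fun t ht =>
    ⟨(one_le_div hX).2 ht.1, (div_le_iff₀ hX).2 ht.2⟩
  have hder : ∀ t ∈ Set.Icc X (c * X),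
      HasDerivAt (fun t => g (t / X)) (g' (t / X) * (1 / X)) t := fun t ht =>
    (hg _ (hmem t ht)).comp t ((hasDerivAt_id t).div_const X)
  have hle : X ≤ c * X := le_mul_of_one_le_left hX.le hc.le
  have habel := sum_mul_eq_sub_sub_integral_mul (fun k : ℕ => if k.Prime then (1 : ℝ) else 0)
    (f := fun t => g (t / X)) hX.le hle (fun t ht => (hder t ht).differentiableAt) (by
      refine (ContinuousOn.integrableOn_Icc (f := fun t => g' (t / X) * (1 / X)) ?_).congr_fun
        (fun t ht => ((hder t ht).deriv).symm) measurableSet_Icc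
      exact (hg'.comp (by fun_prop) hmem).mul continuousOn_const)
  simp only [hpi, mul_ite, mul_one, mul_zero, ← Finset.sum_filter] at habel
  have hsubst : ∫ t in Set.Ioc X (c * X), deriv (fun t => g (t / X)) t * Nat.primeCounting ⌊t⌋₊
      = ∫ v in (1 : ℝ)..c, g' v * Nat.primeCounting ⌊v * X⌋₊ := by
    rw [MeasureTheory.setIntegral_congr_fun
      (g := fun t => g' (t / X) * (1 / X) * Nat.primeCounting ⌊t⌋₊) measurableSet_Ioc
      (fun t ht => by
        simp only
        rw [(hder t (Set.Ioc_subset_Icc_self ht)).deriv]),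
      ← intervalIntegral.integral_of_le hle]
    have h := intervalIntegral.mul_integral_comp_mul_right (a := 1) (b := c)
      (f := fun t => g' (t / X) * (1 / X) * Nat.primeCounting ⌊t⌋₊) X
    rw [one_mul] at h
    rw [← h, ← intervalIntegral.integral_const_mul]
    refine intervalIntegral.integral_congr fun v _ => ?_
    simp only [mul_div_cancel_right₀ _ hX.ne']
    field_simp
  have hint2 : ∫ v in (1 : ℝ)..c, g' v * (Real.log X / X * (Nat.primeCounting ⌊v * X⌋₊ : ℝ))
      = Real.log X / X * ∫ v in (1 : ℝ)..c, g' v * Nat.primeCounting ⌊v * X⌋₊ := by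
    rw [← intervalIntegral.integral_const_mul]
    exact intervalIntegral.integral_congr fun v _ => mul_left_comm _ _ _
  rw [habel, hsubst, hint2, mul_div_cancel_right₀ _ hX.ne', div_self hX.ne', one_mul]
  ring

lemma leastPrime_mem (x : ℝ) : (leastPrime x).Prime ∧ x ≤ (leastPrime x : ℝ) := by
  obtain ⟨p, hp, hpp⟩ := Nat.exists_infinite_primes ⌈x⌉₊
  exact Nat.sInf_mem (s := {p : ℕ | p.Prime ∧ x ≤ (p : ℝ)}) ⟨p, hpp, Nat.ceil_le.1 hp⟩

/-- The least prime above `y * X` is asymptotic to `y * X`. -/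
lemma tendsto_leastPrime_mul_div {y : ℝ} (hy : 0 < y) :
    Tendsto (fun X : ℝ => (leastPrime (y * X) : ℝ) / X) atTop (𝓝 y) := by
  refine tendsto_order.2 ⟨fun a ha => ?_, fun b hb => ?_⟩
  · filter_upwards [eventually_gt_atTop 0] with X hX
    exact ha.trans_le ((le_div_iff₀ hX).2 (leastPrime_mem _).2)
  · obtain ⟨d, hyd, hdb⟩ := exists_between hb
    filter_upwards [eventually_gt_atTop 1, (tendsto_log_div_mul_primeCounting hy).eventually_lt
      (tendsto_log_div_mul_primeCounting (hy.trans hyd)) hyd] with X hX hlt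
    have hX0 : 0 < X := by linarith
    have hpos : 0 < Real.log X / X := div_pos (Real.log_pos hX) hX0
    have hlt' : Nat.primeCounting ⌊y * X⌋₊ < Nat.primeCounting ⌊d * X⌋₊ :=
      Nat.cast_lt.1 (lt_of_mul_lt_mul_left hlt hpos.le)
    obtain ⟨p, hpp, hp1, hp2⟩ : ∃ p : ℕ, p.Prime ∧ ⌊y * X⌋₊ < p ∧ p ≤ ⌊d * X⌋₊ := by
      by_contra! hno
      refine hlt'.not_ge ?_
      simp only [Nat.primeCounting, Nat.primeCounting', Nat.count_eq_card_filter_range]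
      refine Finset.card_le_card fun p hp => ?_
      simp only [Finset.mem_filter, Finset.mem_range, Nat.lt_succ_iff] at hp ⊢
      refine ⟨?_, hp.2⟩
      by_contra! hlt2
      exact (hno p hp.2 (by omega)).not_ge (by omega)
    have hle : leastPrime (y * X) ≤ p := Nat.sInf_le ⟨hpp, (Nat.lt_of_floor_lt hp1).le⟩
    refine lt_of_le_of_lt ?_ hdb
    rw [div_le_iff₀ hX0]
    exact (Nat.cast_le.2 hle).trans ((Nat.le_floor_iff (mul_pos (hy.trans hyd) hX0).le).1 hp2)

/-- For `N` and `p` prime, the normalised sum over even primitive characters is close to a cosine,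
with an exceptional value when `N = p`. -/
lemma norm_finsum_even_primitive_sub_cos_le {N p : ℕ} (hN : N.Prime) (hp : p.Prime) :
    ‖(∑ᶠ χ ∈ {χ : DirichletCharacter ℂ N | χ.IsPrimitive ∧ χ (-1) = 1},
      χ (p : ZMod N) / gaussSum' χ) - (Real.cos (2 * Real.pi * p / N) : ℂ)‖
      ≤ 2 / N + if N = p then 1 else 0 := by
  have hN0 : (0 : ℝ) < N := Nat.cast_pos.2 hN.pos
  by_cases h : N = p
  · subst h
    have h0 : ∀ χ : DirichletCharacter ℂ N, χ (N : ZMod N) = 0 := by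
      intro χ
      have : Fact N.Prime := ⟨hN⟩
      rw [ZMod.natCast_self]
      exact χ.map_zero
    simp only [h0, zero_div, finsum_zero, zero_sub, norm_neg, if_true, Complex.norm_real,
      Real.norm_eq_abs]
    have := Real.abs_cos_le_one (2 * Real.pi * N / N)
    have : 0 < 2 / (N : ℝ) := by positivity
    linarith
  · rw [finsum_even_primitive_eq hN (fun hd => h ((Nat.prime_dvd_prime_iff_eq hN hp).1 hd)),
      if_neg h, add_zero, ← Complex.ofReal_sub, Complex.norm_real, Real.norm_eq_abs,
      show ∀ C : ℝ, ((N : ℝ) - 1) / N * C + 1 / N - C = (1 - C) / N by intro C; field_simp; ring,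
      abs_div, abs_of_pos hN0]
    refine div_le_div_of_nonneg_right ?_ hN0.le
    have := Real.abs_cos_le_one (2 * Real.pi * p / N)
    rw [abs_le] at this ⊢
    constructor <;> linarith

/-- Replacing the sums over characters by cosines of a fixed frequency, and the primes in
`[X, c * X]` by those in `(X, c * X]`, costs an error controlled by the number of primes. -/
lemma norm_sum_prime_sub_sum_cos_le {y c X : ℝ} (hX : 1 ≤ X) {p : ℕ} (hp : p.Prime) :
    ‖(∑ N ∈ (Finset.range (⌊c * X⌋₊ + 1)).filter
          (fun N : ℕ => N.Prime ∧ X ≤ (N : ℝ) ∧ (N : ℝ) ≤ c * X),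
        ∑ᶠ χ ∈ {χ : DirichletCharacter ℂ N | χ.IsPrimitive ∧ χ (-1) = 1},
          χ (p : ZMod N) / gaussSum' χ) -
      ((∑ N ∈ (Finset.Ioc ⌊X⌋₊ ⌊c * X⌋₊).filter Nat.Prime,
        Real.cos (2 * Real.pi * y / (N / X)) : ℝ) : ℂ)‖
      ≤ Nat.primeCounting ⌊c * X⌋₊ * (2 / X + 2 * Real.pi * |p / X - y|) + 2 := by
  have hX0 : 0 < X := by linarith
  set S := (Finset.range (⌊c * X⌋₊ + 1)).filter
    (fun N : ℕ => N.Prime ∧ X ≤ (N : ℝ) ∧ (N : ℝ) ≤ c * X) with hS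
  set T := (Finset.Ioc ⌊X⌋₊ ⌊c * X⌋₊).filter Nat.Prime with hT
  have hTS : T ⊆ S := by
    intro N hN
    simp only [hT, hS, Finset.mem_filter, Finset.mem_Ioc, Finset.mem_range] at hN ⊢
    exact ⟨by omega, hN.2, (Nat.lt_of_floor_lt hN.1.1).le,
      (Nat.le_floor_iff' hN.2.ne_zero).1 hN.1.2⟩
  have hST : S \ T ⊆ {⌊X⌋₊} := by
    intro N hN
    simp only [hT, hS, Finset.mem_sdiff, Finset.mem_filter, Finset.mem_Ioc, Finset.mem_range,
      Finset.mem_singleton] at hN ⊢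
    have := Nat.floor_le_of_le hN.1.2.2.1
    by_contra hne
    exact hN.2 ⟨⟨by omega, by omega⟩, hN.1.2.1⟩
  have hcard : (S.card : ℝ) ≤ Nat.primeCounting ⌊c * X⌋₊ := by
    rw [Nat.primeCounting, Nat.primeCounting', Nat.count_eq_card_filter_range]
    exact Nat.cast_le.2 (Finset.card_le_card
      (Finset.monotone_filter_right _ fun N _ hN => hN.1))
  rw [show ((∑ N ∈ T, Real.cos (2 * Real.pi * y / (N / X)) : ℝ) : ℂ) =
      ∑ N ∈ S, (Real.cos (2 * Real.pi * y / (N / X)) : ℂ) -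
        ∑ N ∈ S \ T, (Real.cos (2 * Real.pi * y / (N / X)) : ℂ) by
    rw [← Finset.sum_sdiff hTS]
    push_cast
    ring, ← sub_add, ← Finset.sum_sub_distrib]
  have hB : ‖∑ N ∈ S \ T, (Real.cos (2 * Real.pi * y / (N / X)) : ℂ)‖ ≤ 1 := by
    refine (norm_sum_le_of_le (f := fun N : ℕ => (Real.cos (2 * Real.pi * y / (N / X)) : ℂ))
      (n := fun _ => (1 : ℝ)) _ fun N _ => ?_).trans ?_
    · rw [Complex.norm_real]
      exact Real.abs_cos_le_one _
    · have := Finset.card_le_card hST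
      rw [Finset.card_singleton] at this
      simpa using this
  have hA : ∀ N ∈ S, ‖(∑ᶠ χ ∈ {χ : DirichletCharacter ℂ N | χ.IsPrimitive ∧ χ (-1) = 1},
      χ (p : ZMod N) / gaussSum' χ) - (Real.cos (2 * Real.pi * y / (N / X)) : ℂ)‖
      ≤ (2 / X + 2 * Real.pi * |p / X - y|) + if N = p then 1 else 0 := by
    intro N hN
    simp only [hS, Finset.mem_filter] at hN
    have hXN := hN.2.2.1
    have hN0 : (0 : ℝ) < N := by linarith
    have h1 := norm_finsum_even_primitive_sub_cos_le hN.2.1 hp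
    have h2 : ‖(Real.cos (2 * Real.pi * p / N) : ℂ) -
        (Real.cos (2 * Real.pi * y / (N / X)) : ℂ)‖ ≤ 2 * Real.pi * |p / X - y| := by
      rw [← Complex.ofReal_sub, Complex.norm_real, Real.norm_eq_abs]
      refine (Real.abs_cos_sub_cos_le _ _).trans ?_
      rw [show 2 * Real.pi * p / N - 2 * Real.pi * y / (N / X) =
        2 * Real.pi * (p / X - y) * (X / N) by field_simp, abs_mul, abs_mul,
        abs_of_pos Real.two_pi_pos, abs_of_pos (div_pos hX0 hN0)]
      exact mul_le_of_le_one_right (by positivity) ((div_le_one hN0).2 hXN)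
    have h3 : 2 / (N : ℝ) ≤ 2 / X := div_le_div_of_nonneg_left zero_le_two hX0 hXN
    refine (norm_sub_le_norm_sub_add_norm_sub _ _ _).trans ((add_le_add h1 h2).trans ?_)
    linarith
  refine (norm_add_le _ _).trans ?_
  have hsum := norm_sum_le_of_le S hA
  rw [Finset.sum_add_distrib, Finset.sum_const, nsmul_eq_mul, Finset.sum_ite_eq'] at hsum
  have hite : (if p ∈ S then (1 : ℝ) else 0) ≤ 1 := by split_ifs <;> norm_num
  have := mul_le_mul_of_nonneg_right hcard
    (by positivity : 0 ≤ 2 / X + 2 * Real.pi * |p / X - y|)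
  linarith

theorem murmuration_Pplus (y c : ℝ) (hy : 0 < y) (hc : 1 < c) :
    Tendsto (fun X : ℝ => Pplus y X c) atTop
      (𝓝 (Complex.ofReal (∫ x in (1:ℝ)..c, Real.cos (2 * Real.pi * y / x)))) := by
  have hmain := tendsto_log_div_mul_sum_prime (g := fun x => Real.cos (2 * Real.pi * y / x))
    (g' := fun x => -Real.sin (2 * Real.pi * y / x) * (2 * Real.pi * y * (-(x ^ 2)⁻¹))) hc
    (fun v hv => by
      have hv0 : v ≠ 0 := (zero_lt_one.trans_le hv.1).ne'
      simpa only [div_eq_mul_inv] using ((hasDerivAt_inv hv0).const_mul (2 * Real.pi * y)).cos)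
    (fun v hv => by
      have hv0 : v ≠ 0 := (zero_lt_one.trans_le hv.1).ne'
      refine ContinuousAt.continuousWithinAt ?_
      fun_prop (disch := positivity))
  have hlogX : Tendsto (fun X : ℝ => Real.log X / X) atTop (𝓝 0) :=
    Real.isLittleO_log_id_atTop.tendsto_div_nhds_zero
  have herr : Tendsto (fun X : ℝ => Real.log X / X * (Nat.primeCounting ⌊c * X⌋₊ : ℝ) *
      (2 / X + 2 * Real.pi * |leastPrime (y * X) / X - y|) + Real.log X / X * 2) atTop (𝓝 0) := by
    have h1 : Tendsto (fun X : ℝ => 2 / X) atTop (𝓝 0) := tendsto_id.const_div_atTop 2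
    have h2 : Tendsto (fun X : ℝ => |leastPrime (y * X) / X - y|) atTop (𝓝 0) := by
      simpa using ((tendsto_leastPrime_mul_div hy).sub_const y).abs
    simpa using ((tendsto_log_div_mul_primeCounting (zero_lt_one.trans hc)).mul
      (h1.add (h2.const_mul (2 * Real.pi)))).add (hlogX.mul_const 2)
  have hdiff : Tendsto (fun X : ℝ => Pplus y X c - ((Real.log X / X *
      ∑ N ∈ (Finset.Ioc ⌊X⌋₊ ⌊c * X⌋₊).filter Nat.Prime,
        Real.cos (2 * Real.pi * y / (N / X)) : ℝ) : ℂ)) atTop (𝓝 0) := by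
    refine squeeze_zero_norm' ?_ herr
    filter_upwards [eventually_ge_atTop 1] with X hX
    have hpos : 0 ≤ Real.log X / X := div_nonneg (Real.log_nonneg hX) (by linarith)
    rw [Pplus, Complex.ofReal_mul, ← mul_sub, norm_mul, Complex.norm_real,
      Real.norm_of_nonneg hpos]
    refine (mul_le_mul_of_nonneg_left
      (norm_sum_prime_sub_sum_cos_le hX (leastPrime_mem (y * X)).1) hpos).trans_eq ?_
    ring
  simpa using hdiff.add ((Complex.continuous_ofReal.tendsto _).comp hmain)
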